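/- Let R be a symmetric graded root and M the monotone subroot of R produced by the greedy algorithm selecting tips of clusters with strictly increasing heights going down the stem. Then the standard complexes with reflection involutions (C_*(R), J₀) and (C_*(M), J₀) are locally equivalent ι-complexes. -/

import Mathlib

open Polynomial

noncomputable section

abbrev F2 : Type := ZMod 2
abbrev F2U : Type := Polynomial F2

/-- Homology of a module endomorphism viewed as a differential. -/
abbrev Hmlgy {M : Type} [AddCommGroup M] [Module F2U M] (f : M →ₗ[F2U] M) : Type :=
  ↥(LinearMap.ker f) ⧸ (LinearMap.range f).comap (LinearMap.ker f).subtype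

/-- An ι-complex: a ℚ-graded, finitely generated, free chain complex `C` over `𝔽₂[U]`
(`deg U = −2`), supported in gradings differing from some `τ ∈ ℚ` by integers, with
`U⁻¹H_*(C) ≅ 𝔽₂[U,U⁻¹]` (expressed by the `tail` field: there is a `U`-nontorsion cycle
`z` such that any `U`-nontorsion cycle agrees with a `U`-power of `z` up to `U`-powers
and boundaries), together with a grading-preserving chain map `ι` with `ι²` chain
homotopic to the identity (over `𝔽₂`, signs are irrelevant). -/
structure IotaCx where
  C : Type
  [acg : AddCommGroup C]
  [mod : Module F2U C]
  d : C →ₗ[F2U] C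
  iota : C →ₗ[F2U] C
  gr : ℚ → AddSubgroup C
  dd : d ∘ₗ d = 0
  chain : d ∘ₗ iota = iota ∘ₗ d
  internal : DirectSum.IsInternal fun g : ℚ => AddSubgroup.toIntSubmodule (gr g)
  d_homog : ∀ g : ℚ, ∀ x ∈ gr g, d x ∈ gr (g - 1)
  iota_homog : ∀ g : ℚ, ∀ x ∈ gr g, iota x ∈ gr g
  U_homog : ∀ g : ℚ, ∀ x ∈ gr g, (X : F2U) • x ∈ gr (g - 2)
  free : Module.Free F2U C
  fg : Module.Finite F2U C
  tau : ℚ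
  tau_supp : ∀ g : ℚ, gr g ≠ ⊥ → ∃ k : ℤ, g = tau + k
  iota_sq : ∃ H : C →ₗ[F2U] C,
    iota ∘ₗ iota + LinearMap.id = d ∘ₗ H + H ∘ₗ d
  tail : ∃ z : C, d z = 0 ∧ (∀ n : ℕ, (X : F2U) ^ n • z ∉ LinearMap.range d) ∧
    ∀ w : C, d w = 0 → (∀ n : ℕ, (X : F2U) ^ n • w ∉ LinearMap.range d) →
      ∃ a b : ℕ, (X : F2U) ^ a • z + (X : F2U) ^ b • w ∈ LinearMap.range d

attribute [instance] IotaCx.acg IotaCx.mod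

namespace IotaCx

variable (A : IotaCx)

/-- The differential `∂' = ∂ + Q(1+ι)` of the involutive complex
`I⁻(C, ι) = Cone(Q(1+ι) : C → Q·C[−1])`, on `C × Q·C`. -/
def coneD : (A.C × A.C) →ₗ[F2U] (A.C × A.C) :=
  (A.d ∘ₗ LinearMap.fst F2U A.C A.C).prod
    (LinearMap.fst F2U A.C A.C + A.iota ∘ₗ LinearMap.fst F2U A.C A.C
      + A.d ∘ₗ LinearMap.snd F2U A.C A.C)

/-- Multiplication by `Q` on the involutive complex: `(x, Qy) ↦ (0, Qx)`. -/
def coneQ : (A.C × A.C) →ₗ[F2U] (A.C × A.C) :=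
  (0 : (A.C × A.C) →ₗ[F2U] A.C).prod (LinearMap.fst F2U A.C A.C)

/-- The class `z` of the involutive homology `HI⁻ = H(Cone(Q(1+ι)))` lies in grading `r`:
it is represented by a cycle `(x, Qy)` with `x` of degree `r` and `y` of degree `r+1`
(so that `Qy` has degree `r`). -/
def HIgrade (r : ℚ) (z : Hmlgy A.coneD) : Prop :=
  ∃ c : LinearMap.ker A.coneD, c.val.1 ∈ A.gr r ∧ c.val.2 ∈ A.gr (r + 1) ∧
    Submodule.Quotient.mk c = z

/-- The class `z ∈ HI⁻` lies in the image of (the map on homology induced by) `Q`. -/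
def inImQ (z : Hmlgy A.coneD) : Prop :=
  ∃ (c : LinearMap.ker A.coneD) (hq : A.coneQ c.val ∈ LinearMap.ker A.coneD),
    z = Submodule.Quotient.mk (⟨A.coneQ c.val, hq⟩ : LinearMap.ker A.coneD)

/-- The set of gradings `r` of classes `x ∈ HI⁻_r` with `Uⁿx ≠ 0` for all `n` and
`U^m x ∈ Im Q` for some `m`; the invariant `d̄` is the maximum of this set plus `2`. -/
def dbarSet : Set ℚ :=
  { r | ∃ z : Hmlgy A.coneD, A.HIgrade r z ∧ (∀ n : ℕ, (X : F2U) ^ n • z ≠ 0) ∧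
      ∃ m : ℕ, A.inImQ ((X : F2U) ^ m • z) }

/-- The set of gradings `r` of classes `x ∈ HI⁻_r` with `Uⁿx ≠ 0` and `Uⁿx ∉ Im Q` for
all `n`; the invariant `d̲` is the maximum of this set plus `1`. -/
def dlowSet : Set ℚ :=
  { r | ∃ z : Hmlgy A.coneD, A.HIgrade r z ∧
      ∀ n : ℕ, (X : F2U) ^ n • z ≠ 0 ∧ ¬ A.inImQ ((X : F2U) ^ n • z) }

/-- The class `z ∈ H_*(C)` lies in grading `r`. -/
def HCgrade (r : ℚ) (z : Hmlgy A.d) : Prop :=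
  ∃ c : LinearMap.ker A.d, c.val ∈ A.gr r ∧ Submodule.Quotient.mk c = z

/-- The set of gradings `r` of classes `x ∈ H_r(C)` with `Uⁿx ≠ 0` for all `n`;
the ordinary correction term `d` is the maximum of this set plus `2`. -/
def dSet : Set ℚ :=
  { r | ∃ z : Hmlgy A.d, A.HCgrade r z ∧ ∀ n : ℕ, (X : F2U) ^ n • z ≠ 0 }

end IotaCx

/-- A local map of ι-complexes: a grading-preserving chain map commuting with the
involutions up to chain homotopy and inducing an isomorphism on homology after
inverting `U` (its kernel and cokernel on homology are `U`-torsion). -/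
def isLocalMap (A B : IotaCx) (F : A.C →ₗ[F2U] B.C) : Prop :=
  F ∘ₗ A.d = B.d ∘ₗ F ∧
  (∀ g : ℚ, ∀ x ∈ A.gr g, F x ∈ B.gr g) ∧
  (∃ H : A.C →ₗ[F2U] B.C, F ∘ₗ A.iota + B.iota ∘ₗ F = B.d ∘ₗ H + H ∘ₗ A.d) ∧
  (∀ z : A.C, A.d z = 0 → F z ∈ LinearMap.range B.d →
    ∃ n : ℕ, (X : F2U) ^ n • z ∈ LinearMap.range A.d) ∧
  (∀ z : B.C, B.d z = 0 →
    ∃ (n : ℕ) (w : A.C), A.d w = 0 ∧ (X : F2U) ^ n • z + F w ∈ LinearMap.range B.d)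

/-- Local equivalence of ι-complexes: local maps in both directions. -/
def LocalEquiv (A B : IotaCx) : Prop :=
  (∃ F, isLocalMap A B F) ∧ (∃ G, isLocalMap B A G)

/-- Equivalence of ι-complexes: grading-preserving chain homotopy equivalences `F`, `G`
which are homotopy inverse to each other and homotopy-commute with the involutions. -/
def IotaEquiv (A B : IotaCx) : Prop :=
  ∃ (F : A.C →ₗ[F2U] B.C) (G : B.C →ₗ[F2U] A.C),
    F ∘ₗ A.d = B.d ∘ₗ F ∧ G ∘ₗ B.d = A.d ∘ₗ G ∧
    (∀ g : ℚ, ∀ x ∈ A.gr g, F x ∈ B.gr g) ∧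
    (∀ g : ℚ, ∀ x ∈ B.gr g, G x ∈ A.gr g) ∧
    (∃ H : A.C →ₗ[F2U] A.C, G ∘ₗ F + LinearMap.id = A.d ∘ₗ H + H ∘ₗ A.d) ∧
    (∃ H : B.C →ₗ[F2U] B.C, F ∘ₗ G + LinearMap.id = B.d ∘ₗ H + H ∘ₗ B.d) ∧
    (∃ H : A.C →ₗ[F2U] B.C, F ∘ₗ A.iota + B.iota ∘ₗ F = B.d ∘ₗ H + H ∘ₗ A.d) ∧
    (∃ H : B.C →ₗ[F2U] A.C, G ∘ₗ B.iota + A.iota ∘ₗ G = A.d ∘ₗ H + H ∘ₗ B.d)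

/-- A monotone graded root `M(h₁,r₁;…;hₘ,rₘ)`: rationals `h₁ > … > hₘ` and
`r₁ < … < rₘ` with `rᵢ ≤ hᵢ`, all congruent modulo `2ℤ`.  It has an infinite stem
topped at degree `rₘ` and, for each `i`, a symmetric pair of leaves of degree `hᵢ`
attached to the stem at degree `rᵢ`. -/
structure MonotoneRoot where
  m : ℕ
  hm : 0 < m
  h : Fin m → ℚ
  r : Fin m → ℚ
  h_anti : StrictAnti h
  r_mono : StrictMono r
  hr : ∀ i, r i ≤ h i
  parity : ∀ i j, ∃ k : ℤ, h i - r j = 2 * k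

namespace MonotoneRoot

variable (M : MonotoneRoot)

/-- Degrees of the `2m` leaves `v₁, …, vₘ, J₀vₘ, …, J₀v₁` of a monotone root,
in left-to-right order. -/
def lDeg (i : ℕ) : ℚ :=
  if h1 : i < M.m then M.h ⟨i, h1⟩
  else if h2 : 2 * M.m - 1 - i < M.m then M.h ⟨2 * M.m - 1 - i, h2⟩ else 0

/-- Degrees of the `2m − 1` angles of a monotone root, in left-to-right order
(the central angle, with index `m − 1`, has degree `rₘ`). -/
def aDeg (i : ℕ) : ℚ :=
  if h1 : i < M.m then M.r ⟨i, h1⟩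
  else if h2 : 2 * M.m - 2 - i < M.m then M.r ⟨2 * M.m - 2 - i, h2⟩ else 0

end MonotoneRoot

/-- `A` is the standard complex, with reflection involution `J₀`, of the graded-root
data with `N` leaves of degrees `L 0, …, L (N-1)` and `N − 1` angles of degrees
`Ad 0, …, Ad (N-2)`: it has an `𝔽₂[U]`-basis of even generators `v i` (of degree `L i`,
which are cycles) and odd generators `a i` (of degree `Ad i + 1`), with
`∂ (a i) = U^{(L i − Ad i)/2} • v i + U^{(L (i+1) − Ad i)/2} • v (i+1)`, and with the
involution given by `ι (v i) = v (N−1−i)`, `ι (a i) = a (N−2−i)`. -/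
def IsStdCxData (A : IotaCx) (N : ℕ) (L Ad : ℕ → ℚ) : Prop :=
  ∃ (v : ℕ → A.C) (a : ℕ → A.C),
    LinearIndependent F2U
      (Sum.elim (fun i : {i : ℕ // i < N} => v i)
        (fun j : {i : ℕ // i + 1 < N} => a j)) ∧
    Submodule.span F2U (v '' {i | i < N} ∪ a '' {i | i + 1 < N}) = ⊤ ∧
    (∀ i, i < N → A.d (v i) = 0) ∧
    (∀ i, i + 1 < N → A.d (a i) =
      (X : F2U) ^ (⌊(L i - Ad i) / 2⌋).toNat • v i
        + (X : F2U) ^ (⌊(L (i + 1) - Ad i) / 2⌋).toNat • v (i + 1)) ∧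
    (∀ i, i < N → A.iota (v i) = v (N - 1 - i)) ∧
    (∀ i, i + 1 < N → A.iota (a i) = a (N - 2 - i)) ∧
    (∀ i, i < N → v i ∈ A.gr (L i)) ∧
    (∀ i, i + 1 < N → a i ∈ A.gr (Ad i + 1))

/-- `A` is (equivalent to) the standard complex of the monotone graded root `M`,
with its reflection involution `J₀`. -/
def IsStandardCx (A : IotaCx) (M : MonotoneRoot) : Prop :=
  IsStdCxData A (2 * M.m) M.lDeg M.aDeg

/-- `T` is the tensor product over `𝔽₂[U]` of the ι-complexes `A 0, …, A (k-1)`: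
there is an `𝔽₂[U]`-linear identification of `T.C` with `⨂_i (A i).C` under which the
differential, the involution (`ι₁ ⊗ ⋯ ⊗ ι_k`) and the grading of `T` are the tensor
product differential, involution and grading. -/
def IsTensorFamily {k : ℕ} (T : IotaCx) (A : Fin k → IotaCx) : Prop :=
  ∃ e : T.C ≃ₗ[F2U] PiTensorProduct F2U fun i => (A i).C,
    (∀ x : (i : Fin k) → (A i).C,
      T.d (e.symm (PiTensorProduct.tprod F2U x)) =
        ∑ i : Fin k, e.symm (PiTensorProduct.tprod F2U
          (Function.update x i ((A i).d (x i))))) ∧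
    (∀ x : (i : Fin k) → (A i).C,
      T.iota (e.symm (PiTensorProduct.tprod F2U x)) =
        e.symm (PiTensorProduct.tprod F2U fun i => (A i).iota (x i))) ∧
    (∀ (g : Fin k → ℚ) (x : (i : Fin k) → (A i).C), (∀ i, x i ∈ (A i).gr (g i)) →
      e.symm (PiTensorProduct.tprod F2U x) ∈ T.gr (∑ i, g i))

/-- `T` is the tensor product over `𝔽₂[U]` of the ι-complexes `A` and `B`,
with involution `ι_A ⊗ ι_B` and the tensor product differential and grading. -/
def IsTensorOf (T A B : IotaCx) : Prop :=
  ∃ e : T.C ≃ₗ[F2U] TensorProduct F2U A.C B.C,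
    (∀ (x : A.C) (y : B.C),
      T.d (e.symm (x ⊗ₜ[F2U] y)) = e.symm ((A.d x) ⊗ₜ[F2U] y + x ⊗ₜ[F2U] (B.d y))) ∧
    (∀ (x : A.C) (y : B.C),
      T.iota (e.symm (x ⊗ₜ[F2U] y)) = e.symm ((A.iota x) ⊗ₜ[F2U] (B.iota y))) ∧
    (∀ (g₁ g₂ : ℚ) (x : A.C) (y : B.C), x ∈ A.gr g₁ → y ∈ B.gr g₂ →
      e.symm (x ⊗ₜ[F2U] y) ∈ T.gr (g₁ + g₂))

/-- `S` is the ι-complex `T` with all gradings shifted up by `t` (so `S = T[−t]`):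
there is an identification of the underlying complexes and involutions under which
the degree-`g` part of `T` is the degree-`(g+t)` part of `S`. -/
def IsShiftOf (S T : IotaCx) (t : ℚ) : Prop :=
  ∃ e : S.C ≃ₗ[F2U] T.C,
    (∀ x : S.C, T.d (e x) = e (S.d x)) ∧
    (∀ x : S.C, T.iota (e x) = e (S.iota x)) ∧
    (∀ (g : ℚ) (x : T.C), x ∈ T.gr g ↔ e.symm x ∈ S.gr (g + t))

/-- A symmetric graded root: `N ≥ 1` leaves with gradings `h 0, …, h (N-1)` in
left-to-right order and angle gradings `a 0, …, a (N-2)` (the grading of the vertex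
supporting the angle between consecutive leaves), with each angle strictly below the
adjacent leaves, differing from them by even integers, and with the data symmetric
under the reflection `i ↦ N−1−i` (which induces the involution `J`).  The `J`-invariant
vertices are exactly the vertices of the central stem, so there is at most one
`J`-invariant vertex in each grading. -/
structure SymRoot where
  N : ℕ
  hN : 0 < N
  h : ℕ → ℚ
  a : ℕ → ℚ
  ha : ∀ i : ℕ, i + 1 < N → a i < h i ∧ a i < h (i + 1)
  par : ∀ i : ℕ, i + 1 < N →
    (∃ k : ℤ, h i - a i = 2 * k) ∧ (∃ k : ℤ, h (i + 1) - a i = 2 * k)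
  symm_h : ∀ i : ℕ, i < N → h (N - 1 - i) = h i
  symm_a : ∀ i : ℕ, i + 1 < N → a (N - 2 - i) = a i

namespace SymRoot

variable (R : SymRoot)

/-- `A` is the standard complex of the symmetric graded root `R`, with its reflection
involution `J₀`. -/
def IsStdCxSym (A : IotaCx) : Prop :=
  IsStdCxData A R.N (fun i => R.h i) R.a

/-- The base of the (left-half or central) leaf `i`: the grading at which the path from
leaf `i` down the tree first meets the central stem, namely the minimum of the angle
gradings between `i` and its mirror image (or the grading of the leaf itself, for the
central leaf of a root with an odd number of leaves). -/
def base (i : ℕ) : ℚ :=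
  if h2 : 2 * i + 1 < R.N then
    (Finset.Icc i (R.N - 2 - i)).inf' (Finset.nonempty_Icc.mpr (by omega)) R.a
  else R.h i

/-- The tip height of the cluster based at grading `b`: the maximum grading of the
(left-half or central) leaves whose base is `b` (`⊥` if there are none). -/
def tip (b : ℚ) : WithBot ℚ :=
  ((Finset.range R.N).filter fun i => 2 * i + 1 ≤ R.N ∧ R.base i = b).sup
    fun i => ((R.h i : ℚ) : WithBot ℚ)

end SymRoot

/-- `M` is the monotone subroot of the symmetric graded root `R` produced by the greedy
algorithm: starting from the uppermost `J`-invariant vertex and going down the stem, at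
each cluster add its tip(s) exactly when their degree strictly exceeds the degrees of
all previously selected leaves.  Equivalently: the `r`-parameters of `M` are exactly
the base gradings `b` of `R` whose tip height strictly exceeds the tip height of every
higher base (the "record" clusters seen from above), and the corresponding
`h`-parameter of `M` is the tip height of that cluster. -/
def IsGreedySubroot (M : MonotoneRoot) (R : SymRoot) : Prop :=
  (∀ j : Fin M.m,
    (∃ i : ℕ, 2 * i + 1 ≤ R.N ∧ R.base i = M.r j) ∧
    R.tip (M.r j) = ((M.h j : ℚ) : WithBot ℚ)) ∧
  (∀ b : ℚ, (∃ j : Fin M.m, M.r j = b) ↔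
    ((∃ i : ℕ, 2 * i + 1 ≤ R.N ∧ R.base i = b) ∧
      ∀ b' : ℚ, (∃ i' : ℕ, 2 * i' + 1 ≤ R.N ∧ R.base i' = b') → b < b' →
        R.tip b' < R.tip b))

/-! ### Gradings in a fixed coset of `2ℤ` -/

/-- The power of `U` lowering the grading from `x` to `y`. -/
def degExp (x y : ℚ) : ℕ := ⌊(x - y) / 2⌋.toNat

/-- The gradings `q` and `x` differ by an even integer. -/
def EvenDiff (q x : ℚ) : Prop := ∃ k : ℤ, x = q + 2 * k

theorem degExp_eq (q : ℚ) (a b : ℤ) : degExp (q + 2 * a) (q + 2 * b) = (a - b).toNat := by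
  have h : (q + 2 * a - (q + 2 * b)) / 2 = ((a - b : ℤ) : ℚ) := by push_cast; ring
  rw [degExp, h, Int.floor_intCast]

theorem degExp_add {q x y z : ℚ} (hx : EvenDiff q x) (hy : EvenDiff q y) (hz : EvenDiff q z)
    (hxy : y ≤ x) (hyz : z ≤ y) : degExp x y + degExp y z = degExp x z := by
  obtain ⟨a, rfl⟩ := hx
  obtain ⟨b, rfl⟩ := hy
  obtain ⟨c, rfl⟩ := hz
  have h1 : b ≤ a := by
    have : (b : ℚ) ≤ a := by linarith
    exact_mod_cast this
  have h2 : c ≤ b := by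
    have : (c : ℚ) ≤ b := by linarith
    exact_mod_cast this
  simp only [degExp_eq]
  omega

theorem sub_two_mul_degExp {q x y : ℚ} (hx : EvenDiff q x) (hy : EvenDiff q y) (hxy : y ≤ x) :
    x - 2 * degExp x y = y := by
  obtain ⟨a, rfl⟩ := hx
  obtain ⟨b, rfl⟩ := hy
  have h1 : b ≤ a := by
    have : (b : ℚ) ≤ a := by linarith
    exact_mod_cast this
  have h2 : (((a - b).toNat : ℤ) : ℚ) = ((a - b : ℤ) : ℚ) := by rw [Int.toNat_of_nonneg (by omega)]
  rw [degExp_eq]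
  push_cast at h2
  rw [h2]
  ring

theorem EvenDiff.exists_upper_bound {q : ℚ} (L : ℕ → ℚ) (N : ℕ) (h : ∀ i < N, EvenDiff q (L i)) :
    ∃ K, EvenDiff q K ∧ ∀ i < N, L i ≤ K := by
  induction N with
  | zero => exact ⟨q, ⟨0, by simp⟩, by simp⟩
  | succ n ih =>
    obtain ⟨K, hK, hb⟩ := ih fun i hi => h i (by omega)
    refine ⟨max K (L n), ?_, fun i hi => ?_⟩
    · rcases max_choice K (L n) with e | e <;> rw [e]
      exacts [hK, h n (by omega)]
    · rcases Nat.lt_succ_iff_lt_or_eq.mp hi with hi | rfl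
      exacts [(hb i hi).trans (le_max_left _ _), le_max_right _ _]

theorem EvenDiff.exists_lower_bound {q : ℚ} (L : ℕ → ℚ) (N : ℕ) (h : ∀ i < N, EvenDiff q (L i)) :
    ∃ K, EvenDiff q K ∧ ∀ i < N, K ≤ L i := by
  induction N with
  | zero => exact ⟨q, ⟨0, by simp⟩, by simp⟩
  | succ n ih =>
    obtain ⟨K, hK, hb⟩ := ih fun i hi => h i (by omega)
    refine ⟨min K (L n), ?_, fun i hi => ?_⟩
    · rcases min_choice K (L n) with e | e <;> rw [e]
      exacts [hK, h n (by omega)]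
    · rcases Nat.lt_succ_iff_lt_or_eq.mp hi with hi | rfl
      exacts [(min_le_left _ _).trans (hb i hi), min_le_right _ _]

theorem F2U.add_self {W : Type} [AddCommGroup W] [Module F2U W] (x : W) : x + x = 0 := by
  have h : (1 : F2U) + 1 = 0 := CharTwo.add_self_eq_zero 1
  rw [← one_smul F2U x, ← add_smul, h, zero_smul]

/-! ### Gradings on ι-complexes -/

namespace IotaCx

theorem pow_smul_mem_gr (A : IotaCx) (n : ℕ) {g : ℚ} {x : A.C} (hx : x ∈ A.gr g) :
    (X : F2U) ^ n • x ∈ A.gr (g - 2 * n) := by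
  induction n with
  | zero => simpa using hx
  | succ n ih =>
    have h := A.U_homog _ _ ih
    rw [smul_smul, ← pow_succ'] at h
    convert h using 2
    push_cast
    ring

/-- A linear map preserving the gradings of a homogeneous generating set is graded. -/
theorem map_mem_gr_of_span {A B : IotaCx} (F : A.C →ₗ[F2U] B.C) (S : Set A.C)
    (hS : Submodule.span F2U S = ⊤)
    (hF : ∀ x ∈ S, ∃ g, x ∈ A.gr g ∧ F x ∈ B.gr g) (g : ℚ) (x : A.C) (hx : x ∈ A.gr g) :
    F x ∈ B.gr g := by
  classical
  let dA := A.internal.chooseDecomposition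
  let dB := B.internal.chooseDecomposition
  let pA (y : A.C) : A.C := DirectSum.decompose (fun g => AddSubgroup.toIntSubmodule (A.gr g)) y g
  let pB (y : B.C) : B.C := DirectSum.decompose (fun g => AddSubgroup.toIntSubmodule (B.gr g)) y g
  have hom : ∀ (y : A.C) (g' : ℚ), y ∈ A.gr g' → F y ∈ B.gr g' → F (pA y) = pB (F y) := by
    intro y g' h1 h2
    by_cases e : g' = g
    · subst e
      simp only [pA, pB]
      rw [DirectSum.decompose_of_mem_same (fun g => AddSubgroup.toIntSubmodule (A.gr g)) h1,
        DirectSum.decompose_of_mem_same (fun g => AddSubgroup.toIntSubmodule (B.gr g)) h2]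
    · simp only [pA, pB]
      rw [DirectSum.decompose_of_mem_ne (fun g => AddSubgroup.toIntSubmodule (A.gr g)) h1 e,
        DirectSum.decompose_of_mem_ne (fun g => AddSubgroup.toIntSubmodule (B.gr g)) h2 e, map_zero]
  have hadd : ∀ y z : A.C, F (pA y) = pB (F y) → F (pA z) = pB (F z) →
      F (pA (y + z)) = pB (F (y + z)) := by
    intro y z h1 h2
    have e1 : pA (y + z) = pA y + pA z := by simp [pA, DirectSum.decompose_add]
    have e2 : pB (F y + F z) = pB (F y) + pB (F z) := by simp [pB, DirectSum.decompose_add]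
    rw [e1, map_add, map_add, e2, h1, h2]
  have hzero : F (pA 0) = pB (F 0) := by simp [pA, pB]
  have key : ∀ y : A.C, F (pA y) = pB (F y) := by
    intro y
    have hy : y ∈ Submodule.span F2U S := hS ▸ Submodule.mem_top
    induction hy using Submodule.closure_induction with
    | zero => exact hzero
    | add y z _ _ h1 h2 => exact hadd y z h1 h2
    | smul_mem p y hy =>
      obtain ⟨g', h1, h2⟩ := hF y hy
      induction p using Polynomial.induction_on' with
      | add p q hp hq => rw [add_smul]; exact hadd _ _ hp hq
      | monomial n c =>
        have hc : c = 0 ∨ c = 1 := by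
          revert c
          decide
        rcases hc with rfl | rfl
        · simpa using hzero
        · rw [Polynomial.monomial_one_right_eq_X_pow]
          refine hom _ _ (A.pow_smul_mem_gr n h1) ?_
          rw [map_smul]
          exact B.pow_smul_mem_gr n h2
  have h1 : pA x = x := DirectSum.decompose_of_mem_same _ hx
  have h2 := key x
  rw [h1] at h2
  rw [h2]
  exact (DirectSum.decompose (fun g => AddSubgroup.toIntSubmodule (B.gr g)) (F x) g).2

end IotaCx

/-! ### Standard complexes -/

/-- Symmetric leaf and angle gradings in the coset `q + 2ℤ`, with angles below leaves. -/
structure IsPathData (q : ℚ) (N : ℕ) (L Ad : ℕ → ℚ) : Prop where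
  pos : 0 < N
  even_leaf : ∀ i, i < N → EvenDiff q (L i)
  even_angle : ∀ i, i + 1 < N → EvenDiff q (Ad i)
  le_left : ∀ i, i + 1 < N → Ad i ≤ L i
  le_right : ∀ i, i + 1 < N → Ad i ≤ L (i + 1)
  symm_leaf : ∀ i, i < N → L (N - 1 - i) = L i
  symm_angle : ∀ i, i + 1 < N → Ad (N - 2 - i) = Ad i

/-- `v` and `a` are the even and odd generators of the standard complex `A`. -/
structure IsStdGens (A : IotaCx) (N : ℕ) (L Ad : ℕ → ℚ) (v a : ℕ → A.C) : Prop where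
  linInd : LinearIndependent F2U
      (Sum.elim (fun i : {i : ℕ // i < N} => v i) (fun j : {i : ℕ // i + 1 < N} => a j))
  span : Submodule.span F2U (v '' {i | i < N} ∪ a '' {i | i + 1 < N}) = ⊤
  d_leaf : ∀ i, i < N → A.d (v i) = 0
  d_angle : ∀ i, i + 1 < N → A.d (a i) =
      (X : F2U) ^ degExp (L i) (Ad i) • v i + (X : F2U) ^ degExp (L (i + 1)) (Ad i) • v (i + 1)
  iota_leaf : ∀ i, i < N → A.iota (v i) = v (N - 1 - i)
  iota_angle : ∀ i, i + 1 < N → A.iota (a i) = a (N - 2 - i)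
  gr_leaf : ∀ i, i < N → v i ∈ A.gr (L i)
  gr_angle : ∀ i, i + 1 < N → a i ∈ A.gr (Ad i + 1)

theorem IsStdCxData.exists_gens {A : IotaCx} {N : ℕ} {L Ad : ℕ → ℚ} (h : IsStdCxData A N L Ad) :
    ∃ v a, IsStdGens A N L Ad v a := by
  obtain ⟨v, a, h1, h2, h3, h4, h5, h6, h7, h8⟩ := h
  exact ⟨v, a, h1, h2, h3, h4, h5, h6, h7, h8⟩

/-- The chain joining the leaves `x ≤ y` through the angles in between, in grading `g + 1`. -/
def arc {W : Type} [AddCommGroup W] [Module F2U W] (Ad : ℕ → ℚ) (a : ℕ → W) (g : ℚ) (x y : ℕ) : W :=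
  ∑ l ∈ Finset.Ico x y, (X : F2U) ^ degExp (Ad l) g • a l

theorem arc_self {W : Type} [AddCommGroup W] [Module F2U W] (Ad : ℕ → ℚ) (a : ℕ → W) (g : ℚ)
    (x : ℕ) : arc Ad a g x x = 0 := by
  simp [arc]

theorem arc_add_arc {W : Type} [AddCommGroup W] [Module F2U W] (Ad : ℕ → ℚ) (a : ℕ → W) (g : ℚ)
    {x y z : ℕ} (hxy : x ≤ y) (hyz : y ≤ z) :
    arc Ad a g x y + arc Ad a g y z = arc Ad a g x z :=
  Finset.sum_Ico_consecutive _ hxy hyz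

theorem arc_succ {W : Type} [AddCommGroup W] [Module F2U W] (Ad : ℕ → ℚ) (a : ℕ → W) (g : ℚ)
    (x : ℕ) : arc Ad a g x (x + 1) = (X : F2U) ^ degExp (Ad x) g • a x := by
  simp [arc]

theorem pow_smul_arc {W : Type} [AddCommGroup W] [Module F2U W] {q : ℚ} {Ad : ℕ → ℚ} (a : ℕ → W)
    {g g' : ℚ} {x y : ℕ} (hA : ∀ l ∈ Finset.Ico x y, EvenDiff q (Ad l)) (hg : EvenDiff q g)
    (hg' : EvenDiff q g') (hle : ∀ l ∈ Finset.Ico x y, g ≤ Ad l) (hgg : g' ≤ g) :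
    (X : F2U) ^ degExp g g' • arc Ad a g x y = arc Ad a g' x y := by
  rw [arc, arc, Finset.smul_sum]
  refine Finset.sum_congr rfl fun l hl => ?_
  rw [smul_smul, ← pow_add, add_comm, degExp_add (hA l hl) hg hg' (hle l hl) hgg]

namespace IsStdGens

variable {A : IotaCx} {q : ℚ} {N : ℕ} {L Ad : ℕ → ℚ} {v a : ℕ → A.C}

theorem exists_linearMap (h : IsStdGens A N L Ad v a) {W : Type} [AddCommGroup W] [Module F2U W]
    (f g : ℕ → W) : ∃ F : A.C →ₗ[F2U] W,
      (∀ i, i < N → F (v i) = f i) ∧ ∀ i, i + 1 < N → F (a i) = g i := by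
  have hsp : ⊤ ≤ Submodule.span F2U (Set.range
      (Sum.elim (fun i : {i : ℕ // i < N} => v i) (fun j : {i : ℕ // i + 1 < N} => a j))) := by
    rw [← h.span, Set.Sum.elim_range]
    refine Submodule.span_mono (Set.union_subset_union ?_ ?_)
    · rintro _ ⟨i, hi, rfl⟩
      exact ⟨⟨i, hi⟩, rfl⟩
    · rintro _ ⟨i, hi, rfl⟩
      exact ⟨⟨i, hi⟩, rfl⟩
  let b := Module.Basis.mk h.linInd hsp
  refine ⟨b.constr F2U (Sum.elim (fun i => f i) fun j => g j), fun i hi => ?_, fun i hi => ?_⟩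
  · have e : v i = b (Sum.inl ⟨i, hi⟩) := by simp [b]
    rw [e, Module.Basis.constr_basis]
    rfl
  · have e : a i = b (Sum.inr ⟨i, hi⟩) := by simp [b]
    rw [e, Module.Basis.constr_basis]
    rfl

theorem hom_ext (h : IsStdGens A N L Ad v a) {W : Type} [AddCommGroup W] [Module F2U W]
    {F G : A.C →ₗ[F2U] W} (hv : ∀ i, i < N → F (v i) = G (v i))
    (ha : ∀ i, i + 1 < N → F (a i) = G (a i)) : F = G := by
  refine LinearMap.ext_on h.span ?_
  rintro _ (⟨i, hi, rfl⟩ | ⟨i, hi, rfl⟩)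
  exacts [hv i hi, ha i hi]

theorem d_arc (h : IsStdGens A N L Ad v a) (hp : IsPathData q N L Ad) {g : ℚ}
    (hg : EvenDiff q g) {x y : ℕ} (hxy : x ≤ y) (hy : y < N)
    (hle : ∀ l ∈ Finset.Ico x y, g ≤ Ad l) :
    A.d (arc Ad a g x y) =
      (X : F2U) ^ degExp (L x) g • v x + (X : F2U) ^ degExp (L y) g • v y := by
  induction y, hxy using Nat.le_induction with
  | base => rw [arc_self, map_zero, F2U.add_self]
  | succ y hxy ih =>
    have hl : g ≤ Ad y := hle y (Finset.mem_Ico.mpr ⟨hxy, by omega⟩)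
    rw [← arc_add_arc Ad a g hxy (Nat.le_succ y), map_add, ih (by omega) fun l hl => hle l <| by
      simp only [Finset.mem_Ico] at hl ⊢; omega, arc_succ, map_smul, h.d_angle y hy, smul_add,
      smul_smul, smul_smul, ← pow_add, ← pow_add, add_comm (degExp (Ad y) g),
      add_comm (degExp (Ad y) g),
      degExp_add (hp.even_leaf y (by omega)) (hp.even_angle y hy) hg (hp.le_left y hy) hl,
      degExp_add (hp.even_leaf _ hy) (hp.even_angle y hy) hg (hp.le_right y hy) hl,
      add_assoc, ← add_assoc (_ • v y), F2U.add_self, zero_add]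

theorem iota_arc (h : IsStdGens A N L Ad v a) (hp : IsPathData q N L Ad) (g : ℚ) {x y : ℕ}
    (hxy : x ≤ y) (hy : y < N) :
    A.iota (arc Ad a g x y) = arc Ad a g (N - 1 - y) (N - 1 - x) := by
  induction y, hxy using Nat.le_induction with
  | base => rw [arc_self, arc_self, map_zero]
  | succ y hxy ih =>
    have e : N - 1 - y = N - 1 - (y + 1) + 1 := by omega
    have e' : N - 1 - (y + 1) = N - 2 - y := by omega
    rw [← arc_add_arc Ad a g hxy (Nat.le_succ y), map_add, ih (by omega), arc_succ, map_smul,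
      h.iota_angle y hy,
      ← arc_add_arc Ad a g (show N - 1 - (y + 1) ≤ N - 1 - y by omega)
        (show N - 1 - y ≤ N - 1 - x by omega), add_comm]
    congr 1
    rw [e, arc_succ, e', hp.symm_angle y hy]

theorem arc_mem_gr (h : IsStdGens A N L Ad v a) (hp : IsPathData q N L Ad) {g : ℚ}
    (hg : EvenDiff q g) {x y : ℕ} (hy : y < N) (hle : ∀ l ∈ Finset.Ico x y, g ≤ Ad l) :
    arc Ad a g x y ∈ A.gr (g + 1) := by
  refine AddSubgroup.sum_mem _ fun l hl => ?_
  have hl' : l + 1 < N := by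
    simp only [Finset.mem_Ico] at hl
    omega
  have hm := A.pow_smul_mem_gr (degExp (Ad l) g) (h.gr_angle l hl')
  have e := sub_two_mul_degExp (hp.even_angle l hl') hg (hle l hl)
  convert hm using 2
  linarith

/-- The augmentation `v i ↦ U^{(K - L i)/2}`, which detects the homology modulo `U`-torsion. -/
theorem exists_augmentation (h : IsStdGens A N L Ad v a) (hp : IsPathData q N L Ad) {K : ℚ}
    (hK : EvenDiff q K) (hKL : ∀ i < N, L i ≤ K) :
    ∃ e : A.C →ₗ[F2U] F2U, (∀ i, i < N → e (v i) = X ^ degExp K (L i)) ∧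
      (∀ i, i + 1 < N → e (a i) = 0) ∧ (∀ x, e (A.d x) = 0) ∧
      ∃ n : ℕ, ∀ z, A.d z = 0 → e z = 0 → (X : F2U) ^ n • z ∈ LinearMap.range A.d := by
  obtain ⟨D, hD, hDA⟩ := EvenDiff.exists_lower_bound (q := q) Ad (N - 1)
    fun i hi => hp.even_angle i (by omega)
  obtain ⟨D', hD', hD'D, hD0⟩ : ∃ D', EvenDiff q D' ∧ D' ≤ D ∧ D' ≤ L 0 := by
    refine ⟨min D (L 0), ?_, min_le_left _ _, min_le_right _ _⟩
    rcases min_choice D (L 0) with e | e <;> rw [e]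
    exacts [hD, hp.even_leaf 0 hp.pos]
  have hDA' : ∀ i, i + 1 < N → D' ≤ Ad i := fun i hi => hD'D.trans (hDA i (by omega))
  have hDL' : ∀ i, i < N → D' ≤ L i := by
    rintro (_ | i) hi
    exacts [hD0, (hDA' i hi).trans (hp.le_right i hi)]
  obtain ⟨e, ev, ea⟩ := h.exists_linearMap (fun i => (X : F2U) ^ degExp K (L i)) fun _ => 0
  have ed : e ∘ₗ A.d = 0 := by
    refine h.hom_ext (fun i hi => ?_) fun i hi => ?_
    · simp [h.d_leaf i hi]
    · have h1 := degExp_add hK (hp.even_leaf i (by omega)) (hp.even_angle i hi)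
        (hKL i (by omega)) (hp.le_left i hi)
      have h2 := degExp_add hK (hp.even_leaf (i + 1) hi) (hp.even_angle i hi)
        (hKL (i + 1) hi) (hp.le_right i hi)
      rw [LinearMap.comp_apply, h.d_angle i hi, map_add, map_smul, map_smul, ev i (by omega),
        ev (i + 1) hi, smul_eq_mul, smul_eq_mul, ← pow_add, ← pow_add,
        add_comm (degExp (L i) _), h1, add_comm (degExp (L (i + 1)) _), h2,
        F2U.add_self, LinearMap.zero_apply]
  refine ⟨e, ev, ea, fun x => LinearMap.congr_fun ed x, degExp K D', ?_⟩
  obtain ⟨s, sv, sa⟩ := h.exists_linearMap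
    (fun i => (X : F2U) ^ degExp K (L i) • arc Ad a D' 0 i) fun _ => (0 : A.C)
  have hle : ∀ i, i < N → ∀ l ∈ Finset.Ico 0 i, D' ≤ Ad l := fun i hi l hl =>
    hDA' l (by simp only [Finset.mem_Ico] at hl; omega)
  have hs : A.d ∘ₗ s + s ∘ₗ A.d =
      (X : F2U) ^ degExp K D' • LinearMap.id +
        (X : F2U) ^ degExp (L 0) D' • e.smulRight (v 0) := by
    refine h.hom_ext (fun i hi => ?_) fun i hi => ?_
    · simp only [LinearMap.add_apply, LinearMap.comp_apply, LinearMap.smul_apply,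
        LinearMap.id_apply, LinearMap.smulRight_apply]
      rw [h.d_leaf i hi, map_zero, add_zero, sv i hi, ev i hi, map_smul,
        h.d_arc hp hD' (Nat.zero_le i) hi (hle i hi), smul_add, add_comm, smul_smul, ← pow_add,
        degExp_add hK (hp.even_leaf i hi) hD' (hKL i hi) (hDL' i hi), smul_comm]
    · have hi' : i < N := by omega
      have h1 := degExp_add hK (hp.even_leaf i hi') (hp.even_angle i hi)
        (hKL i hi') (hp.le_left i hi)
      have h2 := degExp_add hK (hp.even_leaf (i + 1) hi) (hp.even_angle i hi)
        (hKL (i + 1) hi) (hp.le_right i hi)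
      have h3 := degExp_add hK (hp.even_angle i hi) hD'
        ((hp.le_left i hi).trans (hKL i hi')) (hDA' i hi)
      simp only [LinearMap.add_apply, LinearMap.comp_apply, LinearMap.smul_apply,
        LinearMap.id_apply, LinearMap.smulRight_apply]
      rw [sa i hi, map_zero, zero_add, ea i hi, zero_smul, smul_zero, add_zero, h.d_angle i hi,
        map_add, map_smul, map_smul, sv i hi', sv (i + 1) hi, smul_smul, smul_smul, ← pow_add,
        ← pow_add, add_comm (degExp (L i) _), h1, add_comm (degExp (L (i + 1)) _), h2,
        ← arc_add_arc Ad a D' (Nat.zero_le i) (Nat.le_succ i), smul_add, ← add_assoc,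
        F2U.add_self, zero_add, arc_succ, smul_smul, ← pow_add, h3]
  intro z hz hez
  refine ⟨s z, ?_⟩
  have := LinearMap.congr_fun hs z
  simpa [hz, hez] using this

end IsStdGens

/-- A monotone map of leaves which raises gradings of leaves and of traversed angles, and which
commutes with the reflections up to arcs lying above the leaves, induces a local map. -/
theorem exists_isLocalMap {A B : IotaCx} {q : ℚ} {N N' : ℕ} {L Ad L' Ad' : ℕ → ℚ}
    (hA : IsStdCxData A N L Ad) (hB : IsStdCxData B N' L' Ad') (pA : IsPathData q N L Ad)
    (pB : IsPathData q N' L' Ad') (σ : ℕ → ℕ) (σ_lt : ∀ i, i < N → σ i < N')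
    (σ_mono : ∀ i, i + 1 < N → σ i ≤ σ (i + 1))
    (leaf_le : ∀ i, i < N → L i ≤ L' (σ i))
    (angle_le : ∀ i, i + 1 < N → ∀ l ∈ Finset.Ico (σ i) (σ (i + 1)), Ad i ≤ Ad' l)
    (refl_le : ∀ i, i < N → σ (N - 1 - i) ≤ N' - 1 - σ i)
    (leaf_le_angle : ∀ i, i < N → ∀ l ∈ Finset.Ico (σ (N - 1 - i)) (N' - 1 - σ i), L i ≤ Ad' l) :
    ∃ F, isLocalMap A B F := by
  obtain ⟨v, a, gA⟩ := hA.exists_gens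
  obtain ⟨v', a', gB⟩ := hB.exists_gens
  obtain ⟨F, Fv, Fa⟩ := gA.exists_linearMap
    (fun i => (X : F2U) ^ degExp (L' (σ i)) (L i) • v' (σ i))
    fun i => arc Ad' a' (Ad i) (σ i) (σ (i + 1))
  obtain ⟨H, Hv, Ha⟩ := gA.exists_linearMap
    (fun i => arc Ad' a' (L i) (σ (N - 1 - i)) (N' - 1 - σ i)) fun _ => (0 : B.C)
  have chain : F ∘ₗ A.d = B.d ∘ₗ F := by
    refine gA.hom_ext (fun i hi => ?_) fun i hi => ?_
    · rw [LinearMap.comp_apply, LinearMap.comp_apply, gA.d_leaf i hi, Fv i hi, map_smul,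
        gB.d_leaf _ (σ_lt i hi), map_zero, smul_zero]
    · have hi' : i < N := by omega
      rw [LinearMap.comp_apply, LinearMap.comp_apply, gA.d_angle i hi, Fa i hi,
        gB.d_arc pB (pA.even_angle i hi) (σ_mono i hi) (σ_lt _ hi) (angle_le i hi), map_add,
        map_smul, map_smul, Fv i hi', Fv _ hi, smul_smul, smul_smul, ← pow_add, ← pow_add,
        add_comm (degExp (L i) _), add_comm (degExp (L (i + 1)) _),
        degExp_add (pB.even_leaf _ (σ_lt i hi')) (pA.even_leaf i hi') (pA.even_angle i hi)
          (leaf_le i hi') (pA.le_left i hi),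
        degExp_add (pB.even_leaf _ (σ_lt _ hi)) (pA.even_leaf _ hi) (pA.even_angle i hi)
          (leaf_le _ hi) (pA.le_right i hi)]
  have graded : ∀ g : ℚ, ∀ x ∈ A.gr g, F x ∈ B.gr g := by
    refine IotaCx.map_mem_gr_of_span F _ gA.span ?_
    rintro _ (⟨i, hi, rfl⟩ | ⟨i, hi, rfl⟩)
    · refine ⟨L i, gA.gr_leaf i hi, ?_⟩
      rw [Fv i hi]
      have hm := B.pow_smul_mem_gr (degExp (L' (σ i)) (L i)) (gB.gr_leaf _ (σ_lt i hi))
      rwa [sub_two_mul_degExp (pB.even_leaf _ (σ_lt i hi)) (pA.even_leaf i hi) (leaf_le i hi)]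
        at hm
    · refine ⟨Ad i + 1, gA.gr_angle i hi, ?_⟩
      rw [Fa i hi]
      exact gB.arc_mem_gr pB (pA.even_angle i hi) (σ_lt _ hi) (angle_le i hi)
  have homotopy : F ∘ₗ A.iota + B.iota ∘ₗ F = B.d ∘ₗ H + H ∘ₗ A.d := by
    refine gA.hom_ext (fun i hi => ?_) fun i hi => ?_
    · have hr : N - 1 - i < N := by omega
      have hσ := σ_lt i hi
      simp only [LinearMap.add_apply, LinearMap.comp_apply]
      rw [gA.d_leaf i hi, map_zero, add_zero, gA.iota_leaf i hi, Fv _ hr, Fv i hi, Hv i hi,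
        gB.d_arc pB (pA.even_leaf i hi) (refl_le i hi) (by omega) (leaf_le_angle i hi), map_smul,
        gB.iota_leaf _ hσ, pA.symm_leaf i hi, pB.symm_leaf _ hσ]
    · have hi' : i < N := by omega
      have e1 : N - 1 - (i + 1) = N - 2 - i := by omega
      have e2 : N - 2 - i + 1 = N - 1 - i := by omega
      have m1 := σ_mono i hi
      have m2 := σ_mono (N - 2 - i) (by omega)
      have r1 := refl_le i hi'
      have r2 := refl_le (i + 1) hi
      have l1 := leaf_le_angle i hi'
      have l2 := leaf_le_angle (i + 1) hi
      have b1 := σ_lt i hi'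
      have b2 := σ_lt (i + 1) hi
      rw [e1] at r2 l2
      rw [e2] at m2
      simp only [LinearMap.add_apply, LinearMap.comp_apply]
      have even : ∀ {x y : ℕ}, y < N' → ∀ l ∈ Finset.Ico x y, EvenDiff q (Ad' l) :=
        fun hy l hl => pB.even_angle l (by simp only [Finset.mem_Ico] at hl; omega)
      rw [gA.iota_angle i hi, Fa _ (by omega), Fa i hi, Ha i hi, map_zero, zero_add,
        gB.iota_arc pB _ m1 b2, gA.d_angle i hi, map_add, map_smul, map_smul, Hv i hi', Hv _ hi,
        e1, e2,
        pow_smul_arc a' (even (by omega)) (pA.even_leaf i hi') (pA.even_angle i hi) l1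
          (pA.le_left i hi),
        pow_smul_arc a' (even (by omega)) (pA.even_leaf _ hi) (pA.even_angle i hi) l2
          (pA.le_right i hi), pA.symm_angle i hi]
      have s1 := arc_add_arc Ad' a' (Ad i) m2 r1
      have s2 := arc_add_arc Ad' a' (Ad i) r2 (show N' - 1 - σ (i + 1) ≤ N' - 1 - σ i by omega)
      rw [← sub_eq_zero, sub_eq_add_neg, neg_eq_of_add_eq_zero_left (F2U.add_self _)]
      calc _ = (arc Ad' a' (Ad i) (σ (N - 2 - i)) (σ (N - 1 - i)) +
              arc Ad' a' (Ad i) (σ (N - 1 - i)) (N' - 1 - σ i)) +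
            (arc Ad' a' (Ad i) (σ (N - 2 - i)) (N' - 1 - σ (i + 1)) +
              arc Ad' a' (Ad i) (N' - 1 - σ (i + 1)) (N' - 1 - σ i)) := by abel
        _ = 0 := by rw [s1, s2, F2U.add_self]
  obtain ⟨K₁, hK₁, hb₁⟩ := EvenDiff.exists_upper_bound L N pA.even_leaf
  obtain ⟨K₂, hK₂, hb₂⟩ := EvenDiff.exists_upper_bound L' N' pB.even_leaf
  have hK : EvenDiff q (max K₁ K₂) := by
    rcases max_choice K₁ K₂ with e | e <;> rw [e]
    exacts [hK₁, hK₂]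
  have hKA : ∀ i < N, L i ≤ max K₁ K₂ := fun i hi => (hb₁ i hi).trans (le_max_left _ _)
  have hKB : ∀ i < N', L' i ≤ max K₁ K₂ := fun i hi => (hb₂ i hi).trans (le_max_right _ _)
  obtain ⟨e, ev, ea, ed, n, en⟩ := gA.exists_augmentation pA hK hKA
  obtain ⟨e', ev', ea', ed', n', en'⟩ := gB.exists_augmentation pB hK hKB
  have aug : e' ∘ₗ F = e := by
    refine gA.hom_ext (fun i hi => ?_) fun i hi => ?_
    · rw [LinearMap.comp_apply, Fv i hi, map_smul, ev' _ (σ_lt i hi), ev i hi, smul_eq_mul,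
        ← pow_add, add_comm, degExp_add hK (pB.even_leaf _ (σ_lt i hi)) (pA.even_leaf i hi)
          (hKB _ (σ_lt i hi)) (leaf_le i hi)]
    · rw [LinearMap.comp_apply, Fa i hi, ea i hi, arc, map_sum]
      refine Finset.sum_eq_zero fun l hl => ?_
      have := σ_lt _ hi
      rw [map_smul, ea' l (by simp only [Finset.mem_Ico] at hl; omega), smul_zero]
  refine ⟨F, chain, graded, ⟨H, homotopy⟩, fun z hz hFz => ⟨n, en z hz ?_⟩, fun z hz => ?_⟩
  · obtain ⟨y, hy⟩ := hFz
    rw [← aug, LinearMap.comp_apply, ← hy, ed']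
  · have hw : A.d (e' z • v 0) = 0 := by rw [map_smul, gA.d_leaf 0 pA.pos, smul_zero]
    refine ⟨n' + degExp (max K₁ K₂) (L 0), (X : F2U) ^ n' • e' z • v 0, ?_, ?_⟩
    · rw [map_smul, hw, smul_zero]
    · rw [pow_add, mul_smul, map_smul, ← smul_add]
      refine en' _ ?_ ?_
      · rw [map_add, map_smul, hz, smul_zero, zero_add, ← LinearMap.comp_apply, ← chain,
          LinearMap.comp_apply, hw, map_zero]
      · rw [map_add, map_smul, ← LinearMap.comp_apply, aug, map_smul, ev 0 pA.pos, smul_eq_mul,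
          smul_eq_mul, mul_comm, F2U.add_self]

/-! ### Monotone roots -/

namespace MonotoneRoot

variable (M : MonotoneRoot)

theorem lDeg_of_lt {i : ℕ} (hi : i < M.m) : M.lDeg i = M.h ⟨i, hi⟩ := by
  simp [lDeg, hi]

theorem aDeg_of_lt {i : ℕ} (hi : i < M.m) : M.aDeg i = M.r ⟨i, hi⟩ := by
  simp [aDeg, hi]

theorem lDeg_symm {i : ℕ} (hi : i < 2 * M.m) : M.lDeg (2 * M.m - 1 - i) = M.lDeg i := by
  have e : 2 * M.m - 1 - (2 * M.m - 1 - i) = i := by omega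
  unfold lDeg
  simp only [e]
  split_ifs <;> first | rfl | omega

theorem aDeg_symm {i : ℕ} (hi : i + 1 < 2 * M.m) : M.aDeg (2 * M.m - 2 - i) = M.aDeg i := by
  have e : 2 * M.m - 2 - (2 * M.m - 2 - i) = i := by omega
  unfold aDeg
  simp only [e]
  split_ifs with h1 h2
  · congr 2
    omega
  all_goals rfl

theorem isPathData {q : ℚ} (hh : ∀ j, EvenDiff q (M.h j)) (hr : ∀ j, EvenDiff q (M.r j)) :
    IsPathData q (2 * M.m) M.lDeg M.aDeg := by
  have hm := M.hm
  have left : ∀ i, i < M.m → M.aDeg i ≤ M.lDeg i := fun i hi => by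
    rw [M.aDeg_of_lt hi, M.lDeg_of_lt hi]
    exact M.hr _
  have right : ∀ i, i + 1 < M.m → M.aDeg i ≤ M.lDeg (i + 1) := fun i hi => by
    rw [M.aDeg_of_lt (by omega), M.lDeg_of_lt hi]
    exact (M.r_mono (by simp)).le.trans (M.hr _)
  refine ⟨by omega, fun i hi => ?_, fun i hi => ?_, fun i hi => ?_, fun i hi => ?_,
    fun i hi => M.lDeg_symm hi, fun i hi => M.aDeg_symm hi⟩
  · rcases lt_or_ge i M.m with h | h
    · rw [M.lDeg_of_lt h]
      exact hh _
    · rw [← M.lDeg_symm hi, M.lDeg_of_lt (by omega)]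
      exact hh _
  · rcases lt_or_ge i M.m with h | h
    · rw [M.aDeg_of_lt h]
      exact hr _
    · rw [← M.aDeg_symm hi, M.aDeg_of_lt (by omega)]
      exact hr _
  · rcases lt_or_ge i M.m with h | h
    · exact left i h
    · have := right (2 * M.m - 2 - i) (by omega)
      rwa [M.aDeg_symm hi, show 2 * M.m - 2 - i + 1 = 2 * M.m - 1 - i by omega,
        M.lDeg_symm (by omega)] at this
  · rcases lt_or_ge (i + 1) M.m with h | h
    · exact right i h
    · have := left (2 * M.m - 2 - i) (by omega)
      rwa [M.aDeg_symm hi, show 2 * M.m - 2 - i = 2 * M.m - 1 - (i + 1) by omega,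
        M.lDeg_symm (by omega)] at this

end MonotoneRoot

/-! ### Symmetric graded roots -/

namespace SymRoot

variable (R : SymRoot)

theorem evenDiff_h {i : ℕ} (hi : i < R.N) : EvenDiff (R.h 0) (R.h i) := by
  induction i with
  | zero => exact ⟨0, by simp⟩
  | succ i ih =>
    obtain ⟨k, hk⟩ := ih (by omega)
    obtain ⟨⟨k₁, h₁⟩, k₂, h₂⟩ := R.par i hi
    refine ⟨k - k₁ + k₂, ?_⟩
    push_cast
    linarith

theorem evenDiff_a {i : ℕ} (hi : i + 1 < R.N) : EvenDiff (R.h 0) (R.a i) := by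
  obtain ⟨k, hk⟩ := R.evenDiff_h (show i < R.N by omega)
  obtain ⟨⟨k₁, h₁⟩, -⟩ := R.par i hi
  refine ⟨k - k₁, ?_⟩
  push_cast
  linarith

theorem isPathData : IsPathData (R.h 0) R.N (fun i => R.h i) R.a :=
  ⟨R.hN, fun _ => R.evenDiff_h, fun _ => R.evenDiff_a, fun i hi => (R.ha i hi).1.le,
    fun i hi => (R.ha i hi).2.le, R.symm_h, R.symm_a⟩

theorem base_le_a {i k : ℕ} (h : i ≤ k) (hk : k + i + 2 ≤ R.N) : R.base i ≤ R.a k := by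
  rw [base, dif_pos (by omega)]
  exact Finset.inf'_le _ (Finset.mem_Icc.mpr ⟨h, by omega⟩)

theorem exists_base_eq_a {i : ℕ} (hi : 2 * i + 1 < R.N) :
    ∃ k, i ≤ k ∧ k + i + 2 ≤ R.N ∧ R.base i = R.a k := by
  rw [base, dif_pos hi]
  obtain ⟨k, hk, e⟩ := Finset.exists_mem_eq_inf'
    (Finset.nonempty_Icc.mpr (show i ≤ R.N - 2 - i by omega)) R.a
  rw [Finset.mem_Icc] at hk
  exact ⟨k, hk.1, by omega, e⟩

theorem base_central {i : ℕ} (hi : 2 * i + 1 = R.N) : R.base i = R.h i := by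
  rw [base, dif_neg (by omega)]

theorem evenDiff_base {i : ℕ} (hi : 2 * i + 1 ≤ R.N) : EvenDiff (R.h 0) (R.base i) := by
  rcases hi.lt_or_eq with hi | hi
  · obtain ⟨k, h1, h2, e⟩ := R.exists_base_eq_a hi
    rw [e]
    exact R.evenDiff_a (by omega)
  · rw [R.base_central hi]
    exact R.evenDiff_h (by omega)

theorem base_mono {i j : ℕ} (hij : i ≤ j) (hj : 2 * j + 1 ≤ R.N) : R.base i ≤ R.base j := by
  rcases hij.lt_or_eq with hij | rfl
  · rcases hj.lt_or_eq with hj | hj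
    · obtain ⟨k, h1, h2, e⟩ := R.exists_base_eq_a hj
      rw [e]
      exact R.base_le_a (by omega) (by omega)
    · obtain ⟨k, rfl⟩ : ∃ k, j = k + 1 := ⟨j - 1, by omega⟩
      rw [R.base_central hj]
      exact (R.base_le_a (by omega) (by omega)).trans (R.ha k (by omega)).2.le
  · rfl

theorem a_le_base_or {k : ℕ} (hk : 2 * k + 2 ≤ R.N) :
    R.a k ≤ R.base k ∨ 2 * k + 4 ≤ R.N ∧ R.base k = R.base (k + 1) := by
  obtain ⟨l, h1, h2, e⟩ := R.exists_base_eq_a (show 2 * k + 1 < R.N by omega)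
  by_cases hl : l = k
  · exact Or.inl (by rw [e, hl])
  by_cases hl' : l = R.N - 2 - k
  · exact Or.inl (by rw [e, hl', R.symm_a k (by omega)])
  · refine Or.inr ⟨by omega, (R.base_mono (Nat.le_succ k) (by omega)).antisymm ?_⟩
    rw [e]
    exact R.base_le_a (by omega) (by omega)

theorem h_le_tip {i : ℕ} (hi : 2 * i + 1 ≤ R.N) :
    ((R.h i : ℚ) : WithBot ℚ) ≤ R.tip (R.base i) :=
  Finset.le_sup (f := fun i => ((R.h i : ℚ) : WithBot ℚ))
    (Finset.mem_filter.mpr ⟨Finset.mem_range.mpr (by omega), hi, rfl⟩)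

theorem exists_of_tip_eq {b t : ℚ} (h : R.tip b = (t : WithBot ℚ)) :
    ∃ i, 2 * i + 1 ≤ R.N ∧ R.base i = b ∧ R.h i = t := by
  rw [tip] at h
  rcases Finset.eq_empty_or_nonempty
    ((Finset.range R.N).filter fun i => 2 * i + 1 ≤ R.N ∧ R.base i = b) with he | hne
  · rw [he] at h
    simp at h
  · obtain ⟨i, hi, e⟩ := Finset.exists_mem_eq_sup _ hne fun i => ((R.h i : ℚ) : WithBot ℚ)
    rw [Finset.mem_filter] at hi
    rw [e] at h
    exact ⟨i, hi.2.1, hi.2.2, WithBot.coe_injective h⟩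

end SymRoot

namespace IsGreedySubroot

variable {M : MonotoneRoot} {R : SymRoot}

theorem exists_leaf (hM : IsGreedySubroot M R) (j : Fin M.m) :
    ∃ i, 2 * i + 1 ≤ R.N ∧ R.base i = M.r j ∧ R.h i = M.h j :=
  R.exists_of_tip_eq (hM.1 j).2

theorem isPathData (hM : IsGreedySubroot M R) :
    IsPathData (R.h 0) (2 * M.m) M.lDeg M.aDeg := by
  refine M.isPathData (fun j => ?_) fun j => ?_ <;>
    obtain ⟨i, hi, hb, hh⟩ := hM.exists_leaf j
  · rw [← hh]
    exact R.evenDiff_h (by omega)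
  · rw [← hb]
    exact R.evenDiff_base hi

/-- Every cluster is dominated by a selected cluster which is at least as high on the stem. -/
theorem exists_dominating (hM : IsGreedySubroot M R) {i : ℕ} (hi : 2 * i + 1 ≤ R.N) :
    ∃ j : Fin M.m, R.base i ≤ M.r j ∧ R.h i ≤ M.h j := by
  let S := (Finset.range R.N).filter fun k => 2 * k + 1 ≤ R.N ∧ R.base i ≤ R.base k
  have hS : S.Nonempty := ⟨i, Finset.mem_filter.mpr ⟨Finset.mem_range.mpr (by omega), hi, le_rfl⟩⟩
  obtain ⟨k, hk, hmax⟩ := S.exists_max_image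
    (fun k => toLex (R.tip (R.base k), R.base k)) hS
  have hk' := (Finset.mem_filter.mp hk).2
  obtain ⟨j, hj⟩ := (hM.2 (R.base k)).mpr ⟨⟨k, hk'.1, rfl⟩, by
    rintro b ⟨l, hl, rfl⟩ hlt
    have h1 := hmax l (Finset.mem_filter.mpr
      ⟨Finset.mem_range.mpr (by omega), hl, hk'.2.trans hlt.le⟩)
    rw [Prod.Lex.toLex_le_toLex] at h1
    exact h1.resolve_right fun h => absurd h.2 (not_le.mpr hlt)⟩
  refine ⟨j, hj ▸ hk'.2, ?_⟩
  have h1 := hmax i (Finset.mem_filter.mpr ⟨Finset.mem_range.mpr (by omega), hi, le_rfl⟩)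
  rw [Prod.Lex.toLex_le_toLex] at h1
  have h2 : R.tip (R.base i) ≤ R.tip (R.base k) := h1.elim le_of_lt fun h => h.1.le
  rw [← hj, (hM.1 j).2] at h2
  exact WithBot.coe_le_coe.mp ((R.h_le_tip hi).trans h2)

/-- The lowest selected cluster which is at least as high on the stem as the leaf `i`. -/
theorem exists_index (hM : IsGreedySubroot M R) (i : ℕ) :
    ∃ s, 2 * i + 1 ≤ R.N → ∃ hs : s < M.m, R.base i ≤ M.r ⟨s, hs⟩ ∧ R.h i ≤ M.h ⟨s, hs⟩ ∧
      ∀ j : Fin M.m, R.base i ≤ M.r j → s ≤ j := by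
  by_cases hi : 2 * i + 1 ≤ R.N
  · obtain ⟨j, hj, hhj⟩ := hM.exists_dominating hi
    let S := (Finset.univ : Finset (Fin M.m)).filter fun j => R.base i ≤ M.r j
    obtain ⟨s, hs, hmin⟩ := S.exists_min_image id ⟨j, by simpa [S] using hj⟩
    refine ⟨s, fun _ => ⟨s.2, by simpa [S] using hs, ?_, fun j' hj' => ?_⟩⟩
    · exact hhj.trans (M.h_anti.antitone (hmin j (by simpa [S] using hj)))
    · exact hmin j' (by simpa [S] using hj')
  · exact ⟨0, fun h => absurd h hi⟩

theorem r_le_base (hM : IsGreedySubroot M R) {c : ℕ} (hc : 2 * c + 1 ≤ R.N)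
    (hc' : R.N ≤ 2 * c + 2) (j : Fin M.m) : M.r j ≤ R.base c := by
  obtain ⟨i, hi, hb, -⟩ := hM.exists_leaf j
  rw [← hb]
  exact R.base_mono (by omega) hc

/-- The retraction of the standard complex of a root onto that of its monotone subroot. -/
theorem exists_retraction (hM : IsGreedySubroot M R) {A B : IotaCx} (hA : R.IsStdCxSym A)
    (hB : IsStandardCx B M) : ∃ F, isLocalMap A B F := by
  choose s hs using hM.exists_index
  have hm := M.hm
  have s_lt : ∀ i, 2 * i + 1 ≤ R.N → s i < M.m := fun i hi => (hs i hi).1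
  have s_mono : ∀ i, 2 * i + 3 ≤ R.N → s i ≤ s (i + 1) := fun i hi => by
    obtain ⟨h1, h2, -, -⟩ := hs (i + 1) (by omega)
    obtain ⟨-, -, -, h3⟩ := hs i (by omega)
    exact h3 ⟨_, h1⟩ ((R.base_mono (Nat.le_succ i) (by omega)).trans h2)
  have base_le : ∀ i, 2 * i + 1 ≤ R.N → ∀ l, s i ≤ l → l < M.m → R.base i ≤ M.aDeg l := by
    intro i hi l hl hlm
    obtain ⟨h1, h2, -, -⟩ := hs i hi
    rw [M.aDeg_of_lt hlm]
    exact h2.trans (M.r_mono.monotone (by simpa using hl))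
  have s_central : ∀ c, 2 * c + 1 ≤ R.N → R.N ≤ 2 * c + 2 → s c = M.m - 1 := by
    intro c hc hc'
    obtain ⟨h1, h2, -, -⟩ := hs c hc
    have h3 := hM.r_le_base hc hc' ⟨M.m - 1, by omega⟩
    have h4 := M.r_mono.le_iff_le.mp (h3.trans h2)
    simp only [Fin.mk_le_mk] at h4
    omega
  have left : ∀ k, 2 * k + 3 ≤ R.N → ∀ l, s k ≤ l → l < s (k + 1) → R.a k ≤ M.aDeg l := by
    intro k hk l h1 h2
    have hlt := s_lt (k + 1) (by omega)
    rcases R.a_le_base_or (show 2 * k + 2 ≤ R.N by omega) with h | ⟨-, h⟩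
    · exact h.trans (base_le k (by omega) l h1 (by omega))
    · obtain ⟨h3, h4, -, -⟩ := hs k (by omega)
      obtain ⟨-, -, -, h5⟩ := hs (k + 1) (by omega)
      have := h5 ⟨_, h3⟩ (h ▸ h4)
      simp only at this
      omega
  have central : ∀ k, 2 * k + 2 ≤ R.N → R.N ≤ 2 * k + 3 → ∀ l, s k ≤ l → l < M.m →
      R.a k ≤ M.aDeg l := by
    intro k hk hk' l h1 h2
    rcases R.a_le_base_or hk with h | ⟨h, -⟩
    · exact h.trans (base_le k (by omega) l h1 h2)
    · omega
  let σ : ℕ → ℕ := fun i => if 2 * i + 1 ≤ R.N then s i else 2 * M.m - 1 - s (R.N - 1 - i)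
  have σ_left : ∀ i, 2 * i + 1 ≤ R.N → σ i = s i := fun i hi => if_pos hi
  have σ_right : ∀ i, R.N < 2 * i + 1 → σ i = 2 * M.m - 1 - s (R.N - 1 - i) :=
    fun i hi => if_neg (by omega)
  have refl_or : ∀ i, i < R.N → σ (R.N - 1 - i) = 2 * M.m - 1 - σ i ∨
      2 * i + 1 = R.N ∧ σ i = M.m - 1 ∧ σ (R.N - 1 - i) = M.m - 1 := by
    intro i hi
    rcases lt_trichotomy (2 * i + 1) R.N with h | h | h
    · left
      rw [σ_left i h.le, σ_right _ (by omega), show R.N - 1 - (R.N - 1 - i) = i by omega]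
    · right
      rw [show R.N - 1 - i = i by omega, σ_left i h.le]
      have := s_central i h.le (by omega)
      exact ⟨h, this, this⟩
    · left
      have := s_lt (R.N - 1 - i) (by omega)
      rw [σ_right i h, σ_left _ (by omega)]
      omega
  refine exists_isLocalMap hA hB R.isPathData hM.isPathData σ (fun i hi => ?_) (fun i hi => ?_)
    (fun i hi => ?_) (fun i hi l hl => ?_) (fun i hi => ?_) (fun i hi l hl => ?_)
  · by_cases h : 2 * i + 1 ≤ R.N
    · have := s_lt i h
      rw [σ_left i h]
      omega
    · rw [σ_right i (by omega)]
      omega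
  · rcases le_or_gt (2 * i + 3) R.N with h | h
    · rw [σ_left i (by omega), σ_left (i + 1) (by omega)]
      exact s_mono i h
    · have h1 := s_lt (R.N - 2 - i) (by omega)
      rw [σ_right (i + 1) (by omega), show R.N - 1 - (i + 1) = R.N - 2 - i by omega]
      by_cases h' : 2 * i + 1 ≤ R.N
      · have h2 := s_lt i h'
        rw [σ_left i h']
        omega
      · have h2 := s_mono (R.N - 2 - i) (by omega)
        rw [show R.N - 2 - i + 1 = R.N - 1 - i by omega] at h2
        rw [σ_right i (by omega)]
        omega
  · have key : ∀ i, 2 * i + 1 ≤ R.N → R.h i ≤ M.lDeg (s i) := fun i hi => by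
      obtain ⟨h1, -, h2, -⟩ := hs i hi
      rwa [M.lDeg_of_lt h1]
    by_cases h : 2 * i + 1 ≤ R.N
    · rw [σ_left i h]
      exact key i h
    · have h1 := s_lt (R.N - 1 - i) (by omega)
      rw [σ_right i (by omega), M.lDeg_symm (by omega), ← R.symm_h i hi]
      exact key _ (by omega)
  · rw [Finset.mem_Ico] at hl
    rcases le_or_gt (2 * i + 3) R.N with h | h
    · rw [σ_left i (by omega), σ_left (i + 1) (by omega)] at hl
      exact left i h l hl.1 hl.2
    · have h1 := s_lt (R.N - 2 - i) (by omega)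
      rw [σ_right (i + 1) (by omega), show R.N - 1 - (i + 1) = R.N - 2 - i by omega] at hl
      by_cases h' : 2 * i + 1 ≤ R.N
      · have h2 := s_central i h' (by omega)
        rw [σ_left i h', h2] at hl
        rw [← M.aDeg_symm (by omega), ← R.symm_a i hi]
        exact central _ (by omega) (by omega) _ (by omega) (by omega)
      · have h2 := s_lt (R.N - 1 - i) (by omega)
        rw [σ_right i (by omega)] at hl
        rw [← M.aDeg_symm (by omega), ← R.symm_a i hi]
        refine left _ (by omega) _ (by omega) ?_
        rw [show R.N - 2 - i + 1 = R.N - 1 - i by omega]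
        omega
  · rcases refl_or i hi with h | ⟨-, h1, h2⟩ <;> omega
  · rw [Finset.mem_Ico] at hl
    rcases refl_or i hi with h | ⟨h, h1, h2⟩
    · omega
    · rw [← R.base_central h]
      have := σ_left i h.le
      exact base_le i h.le l (by omega) (by omega)

/-- The inclusion of the standard complex of the monotone subroot into that of the root. -/
theorem exists_inclusion (hM : IsGreedySubroot M R) {A B : IotaCx} (hA : R.IsStdCxSym A)
    (hB : IsStandardCx B M) : ∃ G, isLocalMap B A G := by
  have hm := M.hm
  have hex : ∀ j : ℕ, ∃ i, ∀ hj : j < M.m,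
      2 * i + 1 ≤ R.N ∧ R.base i = M.r ⟨j, hj⟩ ∧ R.h i = M.h ⟨j, hj⟩ := by
    intro j
    by_cases hj : j < M.m
    · obtain ⟨i, hi⟩ := hM.exists_leaf ⟨j, hj⟩
      exact ⟨i, fun _ => hi⟩
    · exact ⟨0, fun h => absurd h hj⟩
  choose p hp using hex
  have p_lt : ∀ j, j < M.m → 2 * p j + 1 ≤ R.N := fun j hj => (hp j hj).1
  have p_mono : ∀ j, j + 1 < M.m → p j ≤ p (j + 1) := by
    intro j hj
    by_contra! h
    have h1 := R.base_mono h.le (p_lt j (by omega))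
    rw [(hp j (by omega)).2.1, (hp (j + 1) hj).2.1, M.r_mono.le_iff_le] at h1
    simp at h1
  have left : ∀ k, k < M.m → ∀ l, p k ≤ l → l + p k + 2 ≤ R.N → M.aDeg k ≤ R.a l := by
    intro k hk l h1 h2
    rw [M.aDeg_of_lt hk, ← (hp k hk).2.1]
    exact R.base_le_a h1 h2
  let σ : ℕ → ℕ := fun j => if j < M.m then p j else R.N - 1 - p (2 * M.m - 1 - j)
  have σ_left : ∀ j, j < M.m → σ j = p j := fun j hj => if_pos hj
  have σ_right : ∀ j, M.m ≤ j → σ j = R.N - 1 - p (2 * M.m - 1 - j) :=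
    fun j hj => if_neg (by omega)
  have refl : ∀ j, j < 2 * M.m → σ (2 * M.m - 1 - j) = R.N - 1 - σ j := by
    intro j hj
    by_cases h : j < M.m
    · rw [σ_left j h, σ_right _ (by omega), show 2 * M.m - 1 - (2 * M.m - 1 - j) = j by omega]
    · have := p_lt (2 * M.m - 1 - j) (by omega)
      rw [σ_right j (by omega), σ_left _ (by omega)]
      omega
  refine exists_isLocalMap hB hA hM.isPathData R.isPathData σ (fun i hi => ?_) (fun i hi => ?_)
    (fun i hi => ?_) (fun i hi l hl => ?_) (fun i hi => (refl i hi).le) (fun i hi l hl => ?_)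
  · by_cases h : i < M.m
    · have := p_lt i h
      rw [σ_left i h]
      omega
    · have := R.hN
      rw [σ_right i (by omega)]
      omega
  · rcases lt_or_ge (i + 1) M.m with h | h
    · rw [σ_left i (by omega), σ_left _ h]
      exact p_mono i h
    · have h1 := p_lt (2 * M.m - 2 - i) (by omega)
      rw [σ_right (i + 1) h, show 2 * M.m - 1 - (i + 1) = 2 * M.m - 2 - i by omega]
      by_cases h' : i < M.m
      · have h2 := p_lt i h'
        rw [σ_left i h']
        omega
      · have h2 := p_mono (2 * M.m - 2 - i) (by omega)
        rw [show 2 * M.m - 2 - i + 1 = 2 * M.m - 1 - i by omega] at h2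
        rw [σ_right i (by omega)]
        omega
  · by_cases h : i < M.m
    · rw [σ_left i h, M.lDeg_of_lt h, (hp i h).2.2]
    · have h' : 2 * M.m - 1 - i < M.m := by omega
      have := p_lt _ h'
      rw [σ_right i (by omega), R.symm_h _ (by omega), ← M.lDeg_symm hi, M.lDeg_of_lt h',
        (hp _ h').2.2]
  · rw [Finset.mem_Ico] at hl
    rcases lt_or_ge (i + 1) M.m with h | h
    · have := p_lt _ h
      rw [σ_left i (by omega), σ_left _ h] at hl
      exact left i (by omega) l hl.1 (by omega)
    · have h1 := p_lt (2 * M.m - 2 - i) (by omega)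
      rw [σ_right (i + 1) h, show 2 * M.m - 1 - (i + 1) = 2 * M.m - 2 - i by omega] at hl
      by_cases h' : i < M.m
      · have e : 2 * M.m - 2 - i = i := by omega
        rw [σ_left i h', e] at hl
        exact left i h' l hl.1 (by omega)
      · have h2 := p_lt (2 * M.m - 1 - i) (by omega)
        rw [σ_right i (by omega)] at hl
        rw [← M.aDeg_symm hi, ← R.symm_a l (by omega)]
        exact left _ (by omega) _ (by omega) (by omega)
  · rw [refl i hi, Finset.Ico_self] at hl
    simp at hl

end IsGreedySubroot

/-- Let `R` be a symmetric graded root and `M` the monotone subroot of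
`R` produced by the greedy algorithm selecting tips of clusters with strictly
increasing heights going down the stem.  Then the standard complexes with reflection
involutions `(C_*(R), J₀)` and `(C_*(M), J₀)` are locally equivalent ι-complexes. -/
theorem standard_complex_locally_equivalent_to_monotone_subroot
    (R : SymRoot) (M : MonotoneRoot) (hM : IsGreedySubroot M R)
    (A B : IotaCx) (hA : R.IsStdCxSym A) (hB : IsStandardCx B M) :
    LocalEquiv A B := by
  exact ⟨hM.exists_retraction hA hB, hM.exists_inclusion hA hB⟩
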